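/- arXiv:0809.0127 — 6 statements merged into one kernel-verified Lean document; each statement's English description precedes it below -/
import Mathlib

section
/- For every integer m ≥ 2 and every integer i with 1 ≤ i ≤ m−1, the coefficients of the Boros–Moll polynomial satisfy d_i(m)^2 / (d_{i-1}(m) · d_{i+1}(m)) < ((m−i+1)(i+1)) / ((m−i)·i). -/
/-- The Boros-Moll coefficient `d_i(m)`, as a real number:
`d_i(m) = 4^(-m) * sum_{k=0}^m 2^k * C(2m-2k, m-k) * C(m+k, m) * C(k, i)`. -/
noncomputable def d (m i : ℕ) : ℝ :=
  (∑ k ∈ Finset.range (m + 1),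
      (2 : ℝ) ^ k * (Nat.choose (2 * m - 2 * k) (m - k) : ℝ) *
        (Nat.choose (m + k) m : ℝ) * (Nat.choose k i : ℝ)) / 4 ^ m

/-- The binomial transform `∑ j ≤ n, C(n, j) f(i + j)` of a real sequence. -/
noncomputable def binomialTransform (f : ℕ → ℝ) (n i : ℕ) : ℝ :=
  ∑ j ∈ Finset.range (n + 1), (n.choose j : ℝ) * f (i + j)

theorem binomialTransform_zero (f : ℕ → ℝ) (i : ℕ) : binomialTransform f 0 i = f i := by
  simp [binomialTransform]

theorem binomialTransform_succ (f : ℕ → ℝ) (n i : ℕ) :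
    binomialTransform f (n + 1) i = binomialTransform f n i + binomialTransform f n (i + 1) := by
  unfold binomialTransform
  rw [Finset.sum_range_succ' _ (n + 1)]
  simp only [Nat.choose_succ_succ, Nat.cast_add, add_mul, Finset.sum_add_distrib]
  have h : ∑ j ∈ Finset.range (n + 1), (n.choose j : ℝ) * f (i + j) =
      ∑ j ∈ Finset.range (n + 1), (n.choose (j + 1) : ℝ) * f (i + (j + 1)) + f i := by
    have h' := Finset.sum_range_succ' (fun j => (n.choose j : ℝ) * f (i + j)) (n + 1)
    rw [Finset.sum_range_succ] at h'
    simpa using h'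
  rw [h]
  simp only [Nat.choose_zero_right, Nat.cast_one, one_mul, add_zero, Nat.succ_eq_add_one,
    add_assoc, add_comm 1]
  ring

theorem binomialTransform_pos {f : ℕ → ℝ} {m : ℕ} (hf : ∀ k ≤ m, 0 < f k) (n i : ℕ)
    (h : i + n ≤ m) : 0 < binomialTransform f n i := by
  refine Finset.sum_pos (fun j hj => ?_) ⟨0, by simp⟩
  have hj' : j ≤ n := Nat.lt_succ_iff.mp (Finset.mem_range.mp hj)
  exact mul_pos (by exact_mod_cast Nat.choose_pos hj') (hf _ (by omega))

/-- The binomial transform preserves strict log-convexity. -/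
theorem binomialTransform_logConvex {f : ℕ → ℝ} {m : ℕ} (hf : ∀ k ≤ m, 0 < f k)
    (hlog : ∀ k, k + 2 ≤ m → f (k + 1) ^ 2 < f k * f (k + 2)) (n i : ℕ) (h : i + 2 + n ≤ m) :
    binomialTransform f n (i + 1) ^ 2 < binomialTransform f n i * binomialTransform f n (i + 2) := by
  induction n generalizing i with
  | zero => simpa only [binomialTransform_zero] using hlog i (by omega)
  | succ n ih =>
    have h₁ := ih i (by omega)
    have h₂ := ih (i + 1) (by omega)
    have hx := binomialTransform_pos hf n i (by omega)
    have hy := binomialTransform_pos hf n (i + 1) (by omega)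
    have hz := binomialTransform_pos hf n (i + 2) (by omega)
    simp only [binomialTransform_succ, add_assoc, Nat.reduceAdd] at h₁ h₂ ⊢
    generalize binomialTransform f n i = x at *
    generalize binomialTransform f n (i + 1) = y at *
    generalize binomialTransform f n (i + 2) = z at *
    generalize binomialTransform f n (i + 3) = w at *
    have h₃ : y * z < x * w := by
      have := mul_lt_mul'' h₁ h₂ (by positivity) (by positivity)
      refine lt_of_mul_lt_mul_right (a := y * z) ?_ (by positivity)
      linarith
    nlinarith

/-- The coefficients of the Boros–Moll polynomial in powers of `a + 1`, normalized by `C(m, k)`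
and scaled by `4 ^ m`. -/
noncomputable def borosMollShifted (m k : ℕ) : ℝ :=
  2 ^ k * ((2 * m - 2 * k).choose (m - k) : ℝ) * ((m + k).choose m : ℝ) / (m.choose k : ℝ)

theorem borosMollShifted_pos {m k : ℕ} (h : k ≤ m) : 0 < borosMollShifted m k := by
  have h₁ : 0 < ((2 * m - 2 * k).choose (m - k) : ℝ) := by
    exact_mod_cast Nat.choose_pos (by omega)
  have h₂ : 0 < ((m + k).choose m : ℝ) := by exact_mod_cast Nat.choose_pos (by omega)
  have h₃ : 0 < (m.choose k : ℝ) := by exact_mod_cast Nat.choose_pos h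
  unfold borosMollShifted
  positivity

theorem borosMollShifted_succ (n k : ℕ) :
    (2 * n + 1 : ℝ) * borosMollShifted (n + k + 1) (k + 1) =
      (n + 2 * k + 2) * borosMollShifted (n + k + 1) k := by
  have h₁ : ((n : ℝ) + 1) * (n + 1).centralBinom = 2 * (2 * n + 1) * n.centralBinom := by
    exact_mod_cast Nat.succ_mul_centralBinom_succ n
  have h₂ : ((n : ℝ) + 2 * k + 2) * (n + k + 1 + k).choose (n + k + 1) =
      (n + k + 1 + (k + 1)).choose (n + k + 1) * (k + 1) := by
    have := Nat.add_one_mul_choose_eq (n + k + 1 + k) k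
    rw [Nat.choose_symm_of_eq_add (show n + k + 1 + k = k + (n + k + 1) by omega),
      Nat.choose_symm_of_eq_add
        (show n + k + 1 + k + 1 = (k + 1) + (n + k + 1) by omega)] at this
    have h : ((n + k + 1 + k + 1 : ℕ) : ℝ) * (n + k + 1 + k).choose (n + k + 1) =
      (n + k + 1 + k + 1).choose (n + k + 1) * (k + 1) := by exact_mod_cast this
    rw [← add_assoc, ← h]
    push_cast
    ring
  have h₃ : ((n + k + 1).choose (k + 1) : ℝ) * (k + 1) = (n + k + 1).choose k * (n + 1) := by
    have := Nat.choose_succ_right_eq (n + k + 1) k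
    rw [show n + k + 1 - k = n + 1 by omega] at this
    exact_mod_cast this
  have hp : 0 < ((n + k + 1).choose (k + 1) : ℝ) := by exact_mod_cast Nat.choose_pos (by omega)
  have hq : 0 < ((n + k + 1).choose k : ℝ) := by exact_mod_cast Nat.choose_pos (by omega)
  unfold borosMollShifted
  rw [show 2 * (n + k + 1) - 2 * (k + 1) = 2 * n by omega,
    show n + k + 1 - (k + 1) = n by omega,
    show 2 * (n + k + 1) - 2 * k = 2 * (n + 1) by omega,
    show n + k + 1 - k = n + 1 by omega,
    ← Nat.centralBinom_eq_two_mul_choose, ← Nat.centralBinom_eq_two_mul_choose,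
    ← mul_div_assoc, ← mul_div_assoc, div_eq_div_iff hp.ne' hq.ne']
  have hk : ((k : ℝ) + 1) ≠ 0 := by positivity
  have hn : ((n : ℝ) + 1) ≠ 0 := by positivity
  generalize ((n + k + 1).choose (k + 1) : ℝ) = p at *
  generalize ((n + k + 1).choose k : ℝ) = q at *
  generalize ((n + k + 1 + k).choose (n + k + 1) : ℝ) = r at *
  generalize ((n + k + 1 + (k + 1)).choose (n + k + 1) : ℝ) = s at *
  generalize (n.centralBinom : ℝ) = u at *
  generalize ((n + 1).centralBinom : ℝ) = v at *
  apply mul_right_cancel₀ hk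
  rw [pow_succ]
  linear_combination (-(2 : ℝ) ^ k * s * q * (k + 1)) * h₁ - (2 : ℝ) ^ k * v * p * (k + 1) * h₂
    - (2 : ℝ) ^ k * v * s * (k + 1) * h₃

theorem borosMollShifted_logConvex {m k : ℕ} (h : k + 2 ≤ m) :
    borosMollShifted m (k + 1) ^ 2 < borosMollShifted m k * borosMollShifted m (k + 2) := by
  obtain ⟨n, rfl⟩ := Nat.exists_eq_add_of_le h
  have hx := borosMollShifted_pos (show k ≤ k + 2 + n by omega)
  have hy := borosMollShifted_pos (show k + 1 ≤ k + 2 + n by omega)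
  have h₁ := borosMollShifted_succ (n + 1) k
  have h₂ := borosMollShifted_succ n (k + 1)
  rw [show n + 1 + k + 1 = k + 2 + n by omega] at h₁
  rw [show n + (k + 1) + 1 = k + 2 + n by omega, show k + 1 + 1 = k + 2 by omega] at h₂
  push_cast at h₁ h₂
  generalize borosMollShifted (k + 2 + n) k = x at *
  generalize borosMollShifted (k + 2 + n) (k + 1) = y at *
  generalize borosMollShifted (k + 2 + n) (k + 2) = z at *
  have hz : z = (n + 2 * (k + 1) + 2) * y / (2 * n + 1) := by
    rw [eq_div_iff (by positivity)]; linarith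
  have hxy : y = (n + 1 + 2 * k + 2) * x / (2 * (n + 1) + 1) := by
    rw [eq_div_iff (by positivity)]; linarith
  have key : y * (2 * n + 1) < x * (n + 2 * (k + 1) + 2) := by
    rw [hxy, div_mul_eq_mul_div, div_lt_iff₀ (by positivity)]
    have : ((n : ℝ) + 1 + 2 * k + 2) * (2 * n + 1) <
        (n + 2 * (k + 1) + 2) * (2 * (n + 1) + 1) := by
      have hn : (0 : ℝ) ≤ n := n.cast_nonneg
      have hk : (0 : ℝ) ≤ k := k.cast_nonneg
      nlinarith
    nlinarith
  rw [hz, ← mul_div_assoc, lt_div_iff₀ (by positivity)]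
  nlinarith

theorem d_eq_choose_mul_binomialTransform {m i : ℕ} (h : i ≤ m) :
    d m i = m.choose i * binomialTransform (borosMollShifted m) (m - i) i / 4 ^ m := by
  unfold d binomialTransform
  congr 1
  rw [show m + 1 = i + (m - i + 1) by omega, Finset.sum_range_add, Finset.mul_sum,
    Finset.sum_eq_zero, zero_add]
  · refine Finset.sum_congr rfl fun j hj => ?_
    have hj' : i + j ≤ m := by have := Finset.mem_range.mp hj; omega
    have hc : (m.choose (i + j) : ℝ) * (i + j).choose i = m.choose i * (m - i).choose j := by
      have := Nat.choose_mul (n := m) (Nat.le_add_right i j)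
      rw [Nat.add_sub_cancel_left] at this
      exact_mod_cast this
    have hp : (m.choose (i + j) : ℝ) ≠ 0 := by exact_mod_cast (Nat.choose_pos hj').ne'
    rw [← mul_assoc, ← hc, borosMollShifted]
    field_simp
  · intro k hk
    simp [Nat.choose_eq_zero_of_lt (Finset.mem_range.mp hk)]

theorem boros_moll_ratio_upper_bound (m i : ℕ) (hm : 2 ≤ m) (hi : 1 ≤ i) (hi' : i ≤ m - 1) :
    d m i ^ 2 / (d m (i - 1) * d m (i + 1)) <
      (((m : ℝ) - i + 1) * ((i : ℝ) + 1)) / (((m : ℝ) - i) * (i : ℝ)) := by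
  obtain ⟨l, rfl⟩ := Nat.exists_eq_add_of_le' hi
  obtain ⟨n, rfl⟩ := Nat.exists_eq_add_of_le (show l + 2 ≤ m by omega)
  have hf : ∀ k ≤ l + 2 + n, 0 < borosMollShifted (l + 2 + n) k :=
    fun k hk => borosMollShifted_pos hk
  have hlog := binomialTransform_logConvex hf (fun k hk => borosMollShifted_logConvex hk) n l le_rfl
  have hx := binomialTransform_pos hf n l (by omega)
  have hy := binomialTransform_pos hf n (l + 1) (by omega)
  have hz := binomialTransform_pos hf n (l + 2) (by omega)
  have h₁ : ((l + 2 + n).choose (l + 1) : ℝ) * (l + 1) = (l + 2 + n).choose l * (n + 2) := by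
    have := Nat.choose_succ_right_eq (l + 2 + n) l
    rw [show l + 2 + n - l = n + 2 by omega] at this
    exact_mod_cast this
  have h₂ : ((l + 2 + n).choose (l + 2) : ℝ) * (l + 2) = (l + 2 + n).choose (l + 1) * (n + 1) := by
    have := Nat.choose_succ_right_eq (l + 2 + n) (l + 1)
    rw [show l + 2 + n - (l + 1) = n + 1 by omega] at this
    exact_mod_cast this
  have hq : 0 < ((l + 2 + n).choose (l + 1) : ℝ) := by exact_mod_cast Nat.choose_pos (by omega)
  rw [d_eq_choose_mul_binomialTransform (show l + 1 ≤ l + 2 + n by omega),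
    d_eq_choose_mul_binomialTransform (show l + 1 - 1 ≤ l + 2 + n by omega),
    d_eq_choose_mul_binomialTransform (show l + 1 + 1 ≤ l + 2 + n by omega),
    show l + 2 + n - (l + 1) = n + 1 by omega, show l + 2 + n - (l + 1 - 1) = n + 1 + 1 by omega,
    show l + 2 + n - (l + 1 + 1) = n by omega, show l + 1 - 1 = l by omega,
    show l + 1 + 1 = l + 2 by omega]
  simp only [binomialTransform_succ, add_assoc, Nat.reduceAdd] at *
  generalize binomialTransform _ n l = x at *
  generalize binomialTransform _ n (l + 1) = y at *
  generalize binomialTransform _ n (l + 2) = z at *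
  have hp : ((l + (2 + n)).choose l : ℝ) =
      (l + (2 + n)).choose (l + 1) * (l + 1) / (n + 2) := by
    rw [eq_div_iff (by positivity)]; linarith
  have hr : ((l + (2 + n)).choose (l + 2) : ℝ) =
      (l + (2 + n)).choose (l + 1) * (n + 1) / (l + 2) := by
    rw [eq_div_iff (by positivity)]; linarith
  rw [hp, hr]
  generalize ((l + (2 + n)).choose (l + 1) : ℝ) = q at *
  push_cast
  have e₁ : (l : ℝ) + (2 + n) - (l + 1) = n + 1 := by ring
  rw [e₁]
  have hratio : (y + z) ^ 2 / ((x + (y + (y + z))) * z) < 1 := by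
    rw [div_lt_one (by positivity)]
    nlinarith
  have hc : (0 : ℝ) < (n + 1 + 1) * (l + 1 + 1) / ((n + 1) * (l + 1)) := by positivity
  calc _ = (n + 1 + 1) * (l + 1 + 1) / ((n + 1) * (l + 1)) *
        ((y + z) ^ 2 / ((x + (y + (y + z))) * z)) := by
        field_simp
        ring
    _ < (n + 1 + 1) * (l + 1 + 1) / ((n + 1) * (l + 1)) * 1 :=
        mul_lt_mul_of_pos_left hratio hc
    _ = _ := by
        ring
end

section
/- For every integer m ≥ 2 and every integer i with 1 ≤ i ≤ m−1, the coefficients of the Boros–Moll polynomial satisfy d_i(m)^2 / (d_{i-1}(m) · d_{i+1}(m)) > ((m−i+1)(i+1)(m+i)) / ((m−i)·i·(m+i+1)). -/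
/-- The coefficient of `(a + 1) ^ k` in `4 ^ m * P_m(a)`, where `P_m` is the Boros-Moll polynomial. -/
noncomputable def borosMollWeight (m k : ℕ) : ℝ :=
  (2 : ℝ) ^ k * (Nat.choose (2 * m - 2 * k) (m - k) : ℝ) * (Nat.choose (m + k) m : ℝ)

lemma d_eq_sum_borosMollWeight (m i : ℕ) :
    d m i = (∑ k ∈ Finset.range (m + 1), borosMollWeight m k * (Nat.choose k i : ℝ)) / 4 ^ m :=
  rfl

lemma borosMollWeight_pos {m k : ℕ} (hk : k ≤ m) : 0 < borosMollWeight m k := by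
  have h₁ : 0 < Nat.choose (2 * m - 2 * k) (m - k) := Nat.choose_pos (by omega)
  have h₂ : 0 < Nat.choose (m + k) m := Nat.choose_pos (by omega)
  unfold borosMollWeight
  positivity

lemma borosMollWeight_succ {m k : ℕ} (hk : k < m) :
    (2 * (m : ℝ) - 2 * k - 1) * (k + 1) * borosMollWeight m (k + 1) =
      ((m : ℝ) - k) * (m + k + 1) * borosMollWeight m k := by
  obtain ⟨s, rfl⟩ := Nat.exists_eq_add_of_lt hk
  have h₁ : ((s : ℝ) + 1) * (Nat.choose (2 * (s + 1)) (s + 1) : ℝ) =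
      2 * (2 * s + 1) * (Nat.choose (2 * s) s : ℝ) := by
    exact_mod_cast Nat.succ_mul_centralBinom_succ s
  have h₂ : (Nat.choose (k + s + 1 + k) (k + s + 1) : ℝ) * (k + s + 1 + k + 1) =
      (Nat.choose (k + s + 1 + (k + 1)) (k + s + 1) : ℝ) * (k + 1) := by
    have h := Nat.choose_mul_succ_eq (k + s + 1 + k) (k + s + 1)
    rw [show k + s + 1 + k + 1 - (k + s + 1) = k + 1 by omega] at h
    exact_mod_cast h
  unfold borosMollWeight
  rw [show 2 * (k + s + 1) - 2 * (k + 1) = 2 * s by omega,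
    show k + s + 1 - (k + 1) = s by omega,
    show 2 * (k + s + 1) - 2 * k = 2 * (s + 1) by omega,
    show k + s + 1 - k = s + 1 by omega]
  push_cast
  rw [pow_succ]
  linear_combination
    (-(2 : ℝ) ^ k * 2 * (2 * s + 1) * (Nat.choose (2 * s) s : ℝ)) * h₂ -
      (2 : ℝ) ^ k * (k + s + 1 + k + 1) * (Nat.choose (k + s + 1 + k) (k + s + 1) : ℝ) * h₁

lemma cast_succ_mul_choose_succ (k j : ℕ) :
    ((j : ℝ) + 1) * (Nat.choose k (j + 1) : ℝ) = ((k : ℝ) - j) * (Nat.choose k j : ℝ) := by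
  rcases le_or_gt j k with h | h
  · have h' := Nat.choose_succ_right_eq k j
    have h'' : (Nat.choose k (j + 1) : ℝ) * (j + 1) = (Nat.choose k j : ℝ) * ((k - j : ℕ) : ℝ) := by
      exact_mod_cast h'
    rw [Nat.cast_sub h] at h''
    linarith
  · simp [Nat.choose_eq_zero_of_lt h, Nat.choose_eq_zero_of_lt (Nat.lt_succ_of_lt h)]

lemma cast_sub_mul_succ_choose (k j : ℕ) :
    ((k : ℝ) + 1 - j) * (Nat.choose (k + 1) j : ℝ) = ((k : ℝ) + 1) * (Nat.choose k j : ℝ) := by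
  have h := cast_succ_mul_choose_succ (k + 1) j
  have h' : ((k : ℝ) + 1) * (Nat.choose k j : ℝ) = (Nat.choose (k + 1) (j + 1) : ℝ) * (j + 1) := by
    exact_mod_cast Nat.add_one_mul_choose_eq k j
  push_cast at h
  linarith

lemma sum_range_borosMollWeight_mul (m j n : ℕ) (hn : n ≤ m) :
    ∑ k ∈ Finset.range n, borosMollWeight m k * (Nat.choose k j : ℝ) *
        (((m : ℝ) - j) * (m + j + 1) - (2 * m + 1) * (k - j) + (k - j) * (k - j - 1)) =
      borosMollWeight m n * (2 * m - 2 * n + 1) * ((n - j) * (Nat.choose n j : ℝ)) := by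
  induction n with
  | zero => cases j <;> simp
  | succ n ih =>
    rw [Finset.sum_range_succ, ih (by omega)]
    have h₁ := borosMollWeight_succ (m := m) (k := n) (by omega)
    have h₂ := cast_sub_mul_succ_choose n j
    push_cast
    rw [h₂]
    linear_combination -(Nat.choose n j : ℝ) * h₁

/-- The three-term recurrence in `i` for the Boros-Moll coefficients. -/
lemma d_recurrence (m j : ℕ) :
    ((m : ℝ) - j) * (m + j + 1) * d m j - (j + 1) * (2 * m + 1) * d m (j + 1) +
      (j + 1) * (j + 2) * d m (j + 2) = 0 := by
  have hsum : ∑ k ∈ Finset.range (m + 1), borosMollWeight m k * (Nat.choose k j : ℝ) *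
      (((m : ℝ) - j) * (m + j + 1) - (2 * m + 1) * (k - j) + (k - j) * (k - j - 1)) = 0 := by
    rw [Finset.sum_range_succ, sum_range_borosMollWeight_mul m j m le_rfl]
    ring
  simp only [d_eq_sum_borosMollWeight, mul_div_assoc']
  rw [← sub_div, ← add_div, Finset.mul_sum, Finset.mul_sum, Finset.mul_sum,
    ← Finset.sum_sub_distrib, ← Finset.sum_add_distrib, div_eq_zero_iff]
  left
  rw [← hsum]
  refine Finset.sum_congr rfl fun k _ => ?_
  have h₁ := cast_succ_mul_choose_succ k j
  have h₂ := cast_succ_mul_choose_succ k (j + 1)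
  push_cast at h₂
  linear_combination borosMollWeight m k * (-(2 * (m : ℝ) + 1) + (k - j - 1)) * h₁ +
    borosMollWeight m k * (j + 1) * h₂

lemma d_pos {m i : ℕ} (hi : i ≤ m) : 0 < d m i := by
  rw [d_eq_sum_borosMollWeight]
  refine div_pos (Finset.sum_pos' (fun k hk => ?_) ⟨m, by simp, ?_⟩) (by positivity)
  · exact mul_nonneg (borosMollWeight_pos (Finset.mem_range_succ_iff.mp hk)).le (Nat.cast_nonneg _)
  · exact mul_pos (borosMollWeight_pos le_rfl) (Nat.cast_pos.mpr (Nat.choose_pos hi))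

lemma succ_mul_d_succ_lt {m i : ℕ} (hi : i < m) :
    ((i : ℝ) + 1) * d m (i + 1) < ((m : ℝ) - i) * d m i := by
  simp only [d_eq_sum_borosMollWeight, mul_div_assoc']
  refine div_lt_div_of_pos_right ?_ (by positivity)
  rw [Finset.mul_sum, Finset.mul_sum]
  have key : ∀ k, ((m : ℝ) - i) * (borosMollWeight m k * (Nat.choose k i : ℝ)) -
      ((i : ℝ) + 1) * (borosMollWeight m k * (Nat.choose k (i + 1) : ℝ)) =
      ((m : ℝ) - k) * (borosMollWeight m k * (Nat.choose k i : ℝ)) := fun k => by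
    linear_combination -borosMollWeight m k * cast_succ_mul_choose_succ k i
  refine Finset.sum_lt_sum (fun k hk => ?_) ⟨i, Finset.mem_range.mpr (by omega), ?_⟩
  · have hk' : k ≤ m := Finset.mem_range_succ_iff.mp hk
    rw [← sub_nonneg, key]
    exact mul_nonneg (sub_nonneg.mpr (Nat.cast_le.mpr hk'))
      (mul_nonneg (borosMollWeight_pos hk').le (Nat.cast_nonneg _))
  · rw [← sub_pos, key, Nat.choose_self, Nat.cast_one, mul_one]
    exact mul_pos (sub_pos.mpr (Nat.cast_lt.mpr hi)) (borosMollWeight_pos hi.le)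

theorem boros_moll_ratio_lower_bound (m i : ℕ) (hm : 2 ≤ m) (hi : 1 ≤ i) (hi' : i ≤ m - 1) :
    d m i ^ 2 / (d m (i - 1) * d m (i + 1)) >
      (((m : ℝ) - i + 1) * ((i : ℝ) + 1) * ((m : ℝ) + i)) /
        (((m : ℝ) - i) * (i : ℝ) * ((m : ℝ) + i + 1)) := by
  obtain ⟨j, rfl⟩ := Nat.exists_eq_add_of_le' hi
  have hlt : j + 1 < m := by omega
  have hA : 0 < d m j := d_pos (by omega)
  have hB : 0 < d m (j + 1) := d_pos (by omega)
  have hC : 0 < d m (j + 2) := d_pos (by omega)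
  have hrec := d_recurrence m j
  have hy := succ_mul_d_succ_lt hlt
  have hmj : (0 : ℝ) < (m : ℝ) - (j + 1 : ℕ) := sub_pos.mpr (Nat.cast_lt.mpr hlt)
  simp only [Nat.add_sub_cancel, add_assoc, Nat.reduceAdd] at hy ⊢
  push_cast at hy hmj ⊢
  rw [gt_iff_lt, div_lt_div_iff₀ (by positivity) (by positivity), ← sub_pos]
  have hy' : 0 < ((m : ℝ) + j + 2) * d m (j + 1) - ((j : ℝ) + 2) * d m (j + 2) := by
    nlinarith [mul_nonneg (Nat.cast_nonneg (α := ℝ) j) hB.le]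
  have hprod : 0 < ((j : ℝ) + 1) * ((((m : ℝ) - (j + 1)) * d m (j + 1) - (j + 2) * d m (j + 2)) *
      (((m : ℝ) + j + 2) * d m (j + 1) - (j + 2) * d m (j + 2))) :=
    mul_pos (by positivity) (mul_pos (by linarith) hy')
  refine hprod.trans_eq ?_
  linear_combination ((j : ℝ) + 2) * d m (j + 2) * hrec
end

section
/- For every integer m ≥ 1, one has d_0(m+1)/d_0(m) = T(m,0), where T(m,0) = (4m^2 + 7m + 3) / (2(m+1)^2). -/
/-- `T(m,i) = (4m^2 + 7m + 3 + i*sqrt(4m + 4i^2 + 1) - 2i^2) / (2(m-i+1)(m+1))`. -/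
noncomputable def T (m i : ℕ) : ℝ :=
  (4 * (m : ℝ) ^ 2 + 7 * m + 3 + i * Real.sqrt (4 * m + 4 * i ^ 2 + 1) - 2 * i ^ 2) /
    (2 * ((m : ℝ) - i + 1) * ((m : ℝ) + 1))

/-- The `k`-th summand of `4 ^ m * d m 0`. -/
noncomputable def borosMollSummand (m k : ℕ) : ℝ :=
  (2 : ℝ) ^ k * (Nat.centralBinom (m - k) : ℝ) * (Nat.choose (m + k) m : ℝ)

theorem d_zero_eq_sum (m : ℕ) :
    d m 0 = (∑ k ∈ Finset.range (m + 1), borosMollSummand m k) / 4 ^ m := by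
  simp [d, borosMollSummand, Nat.centralBinom, Nat.mul_sub]

theorem d_zero_pos (m : ℕ) : 0 < d m 0 := by
  rw [d_zero_eq_sum]
  refine div_pos (Finset.sum_pos (fun k _ => ?_) (by simp)) (by positivity)
  have h₁ := Nat.centralBinom_pos (m - k)
  have h₂ : 0 < Nat.choose (m + k) m := Nat.choose_pos (by omega)
  unfold borosMollSummand
  positivity

theorem succ_mul_centralBinom_succ_cast (n : ℕ) :
    ((n : ℝ) + 1) * (Nat.centralBinom (n + 1) : ℝ) =
      2 * (2 * n + 1) * (Nat.centralBinom n : ℝ) := by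
  exact_mod_cast Nat.succ_mul_centralBinom_succ n

/-- Telescoped form of the Zeilberger recurrence for `borosMollSummand`. -/
theorem sum_borosMollSummand_recurrence (m K : ℕ) (hK : K ≤ m) :
    ∑ k ∈ Finset.range (K + 1),
        (((m : ℝ) + 1) * borosMollSummand (m + 1) k -
          2 * (4 * m + 3) * borosMollSummand m k) =
      -4 * ((m : ℝ) + K + 1) * borosMollSummand m K := by
  induction K with
  | zero =>
    have h := succ_mul_centralBinom_succ_cast m
    simp only [borosMollSummand, zero_add, Finset.sum_range_one, pow_zero, Nat.sub_zero,
      add_zero, Nat.choose_self, Nat.cast_one, Nat.cast_zero]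
    linear_combination h
  | succ K ih =>
    rw [Finset.sum_range_succ, ih (by omega)]
    obtain ⟨n, rfl⟩ : ∃ n, m = K + 1 + n := ⟨m - (K + 1), by omega⟩
    generalize hm : K + 1 + n = m
    have hmr : (m : ℝ) = K + 1 + n := by rw [← hm]; push_cast; ring
    have h₁ := succ_mul_centralBinom_succ_cast n
    have h₂ : ((K : ℝ) + 1) * (Nat.choose (m + (K + 1)) m : ℝ) =
        (m + K + 1) * (Nat.choose (m + K) m : ℝ) := by
      have h := Nat.choose_mul_succ_eq (m + K) m
      rw [show m + K + 1 - m = K + 1 by omega] at h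
      have h' : (Nat.choose (m + K) m : ℝ) * (m + K + 1) =
          (Nat.choose (m + (K + 1)) m : ℝ) * (K + 1) := by exact_mod_cast h
      linear_combination -h'
    have h₃ : ((m : ℝ) + 1) * (Nat.choose (m + 1 + (K + 1)) (m + 1) : ℝ) =
        (m + K + 2) * (Nat.choose (m + (K + 1)) m : ℝ) := by
      have h := Nat.add_one_mul_choose_eq (m + (K + 1)) m
      rw [show m + (K + 1) + 1 = m + 1 + (K + 1) by omega] at h
      have h' : ((m : ℝ) + 1 + (K + 1)) * (Nat.choose (m + (K + 1)) m : ℝ) =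
          (Nat.choose (m + 1 + (K + 1)) (m + 1) : ℝ) * (m + 1) := by exact_mod_cast h
      linear_combination -h'
    simp only [borosMollSummand, show m - K = n + 1 by omega,
      show m + 1 - (K + 1) = n + 1 by omega, show m - (K + 1) = n by omega]
    generalize (Nat.choose (m + (K + 1)) m : ℝ) = b at *
    push_cast
    rw [hmr] at h₂ h₃ ⊢
    linear_combination (2 : ℝ) ^ (K + 1) * b * h₁ +
      4 * (2 : ℝ) ^ K * (Nat.centralBinom (n + 1) : ℝ) * h₂ +
      (2 : ℝ) ^ (K + 1) * (Nat.centralBinom (n + 1) : ℝ) * h₃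

theorem sum_borosMollSummand_succ (m : ℕ) :
    ((m : ℝ) + 1) * ∑ k ∈ Finset.range (m + 2), borosMollSummand (m + 1) k =
      2 * (4 * m + 3) * ∑ k ∈ Finset.range (m + 1), borosMollSummand m k := by
  have h := sum_borosMollSummand_recurrence m m le_rfl
  have hc := succ_mul_centralBinom_succ_cast m
  have hlast : ((m : ℝ) + 1) * borosMollSummand (m + 1) (m + 1) =
      4 * ((m : ℝ) + m + 1) * borosMollSummand m m := by
    simp only [borosMollSummand, Nat.sub_self, Nat.centralBinom_zero, Nat.cast_one, mul_one,
      ← two_mul, ← Nat.centralBinom_eq_two_mul_choose]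
    linear_combination (2 : ℝ) ^ (m + 1) * hc
  rw [Finset.sum_sub_distrib, ← Finset.mul_sum, ← Finset.mul_sum] at h
  rw [Finset.sum_range_succ]
  linear_combination h + hlast

theorem boros_moll_d0_ratio (m : ℕ) (hm : 1 ≤ m) :
    d (m + 1) 0 / d m 0 = T m 0 := by
  have hpos : d m 0 ≠ 0 := (d_zero_pos m).ne'
  have h := sum_borosMollSummand_succ m
  have hm1 : (m : ℝ) + 1 ≠ 0 := by positivity
  have hT : T m 0 = (4 * m + 3) / (2 * (m + 1)) := by
    simp only [T, Nat.cast_zero]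
    field_simp
    ring
  rw [hT, div_eq_div_iff hpos (by positivity), d_zero_eq_sum, d_zero_eq_sum]
  field_simp
  linear_combination 2 * 4 ^ m * h
end

section
/- For every integer m ≥ 2 and every integer i with 1 ≤ i ≤ m−1, one has T(m,i) < F(m,i), where T(m,i) = (4m^2 + 7m + 3 + i·√(4m + 4i^2 + 1) − 2i^2) / (2(m−i+1)(m+1)) and F(m,i) = ((m+i+1)(4m+3)(4m+5)) / (2(m+1)(4m^2 − 2i^2 + 9m + 5 − i·√(4m + 4i^2 + 5))). -/
/-- `F(m,i) = ((m+i+1)(4m+3)(4m+5)) / (2(m+1)(4m^2 - 2i^2 + 9m + 5 - i*sqrt(4m + 4i^2 + 5)))`. -/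
noncomputable def F (m i : ℕ) : ℝ :=
  (((m : ℝ) + i + 1) * (4 * m + 3) * (4 * m + 5)) /
    (2 * ((m : ℝ) + 1) *
      (4 * (m : ℝ) ^ 2 - 2 * i ^ 2 + 9 * m + 5 - i * Real.sqrt (4 * m + 4 * i ^ 2 + 5)))

/-- The cleared-denominator form of the inequality, in terms of `u = (s + t) / 2` and
`v = (t - s) / 2`, where `s` and `t` are the two square roots. -/
lemma mul_lt_of_mul_eq_one {n i u v : ℝ} (hi : 1 ≤ i) (hn : i + 2 ≤ n) (hu : 2 * i + 1 < u)
    (hv : 0 < v) (huv : u * v = 1) (hsq : u ^ 2 + v ^ 2 = 4 * n + 4 * i ^ 2 - 1) :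
    2 * n * u - (8 * n ^ 2 - 4 * i ^ 2) * v < i * (u ^ 2 - v ^ 2 + 1 - 4 * i ^ 2) := by
  have hiv : 2 * i * v < 1 := by nlinarith
  have h₁ : 0 < 4 * n * i * (u - 2 * i - 1) := by
    have : 0 < n := by linarith
    have : 0 < u - 2 * i - 1 := by linarith
    positivity
  have h₂ : 0 ≤ n * v ^ 2 := mul_nonneg (by linarith) (sq_nonneg v)
  have h₃ : 0 ≤ i * (n - i - 2) := mul_nonneg (by linarith) (by linarith)
  have key : 8 * n * i ^ 2 - 2 * n - 2 * n * v ^ 2 + 4 * i ^ 2 < 4 * n * i * u - 2 * i * v := by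
    nlinarith
  have hl : 2 * n * u - (8 * n ^ 2 - 4 * i ^ 2) * v =
      v * (8 * n * i ^ 2 - 2 * n - 2 * n * v ^ 2 + 4 * i ^ 2) := by
    linear_combination (-2 * n * u) * huv + 2 * n * v * hsq
  have hr : i * (u ^ 2 - v ^ 2 + 1 - 4 * i ^ 2) = v * (4 * n * i * u - 2 * i * v) := by
    linear_combination (-4 * n * i) * huv + i * hsq
  rw [hl, hr]
  exact mul_lt_mul_of_pos_left key hv

theorem T_lt_F (m i : ℕ) (hm : 2 ≤ m) (hi : 1 ≤ i) (hi' : i ≤ m - 1) :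
    T m i < F m i := by
  have hi1 : (1 : ℝ) ≤ i := by exact_mod_cast hi
  have him : (i : ℝ) + 1 ≤ m := by exact_mod_cast (by omega : i + 1 ≤ m)
  unfold T F
  generalize (m : ℝ) = x at *
  generalize (i : ℝ) = y at *
  have hs2 : √(4 * x + 4 * y ^ 2 + 1) ^ 2 = 4 * x + 4 * y ^ 2 + 1 := Real.sq_sqrt (by nlinarith)
  have ht2 : √(4 * x + 4 * y ^ 2 + 5) ^ 2 = 4 * x + 4 * y ^ 2 + 5 := Real.sq_sqrt (by nlinarith)
  have hs : 2 * y + 1 < √(4 * x + 4 * y ^ 2 + 1) := Real.lt_sqrt_of_sq_lt (by nlinarith)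
  have hst : √(4 * x + 4 * y ^ 2 + 1) < √(4 * x + 4 * y ^ 2 + 5) :=
    Real.sqrt_lt_sqrt (by nlinarith) (by linarith)
  have ht : √(4 * x + 4 * y ^ 2 + 5) < 2 * x + 1 := by
    rw [Real.sqrt_lt' (by linarith)]
    nlinarith
  generalize √(4 * x + 4 * y ^ 2 + 1) = s at *
  generalize √(4 * x + 4 * y ^ 2 + 5) = t at *
  have key := mul_lt_of_mul_eq_one (n := x + 1) (u := (s + t) / 2) (v := (t - s) / 2) hi1
    (by linarith) (by linarith) (by linarith) (by linarith) (by linarith)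
  have hB : 0 < 4 * x ^ 2 - 2 * y ^ 2 + 9 * x + 5 - y * t := by nlinarith
  have hx : 0 < x + 1 := by linarith
  have hxy : 0 < x - y + 1 := by linarith
  rw [div_lt_div_iff₀ (by positivity) (by positivity)]
  have main : (4 * x ^ 2 + 7 * x + 3 + y * s - 2 * y ^ 2) *
      (4 * x ^ 2 - 2 * y ^ 2 + 9 * x + 5 - y * t) <
      (x + y + 1) * (4 * x + 3) * (4 * x + 5) * (x - y + 1) := by
    linear_combination y * key
  linear_combination 2 * (x + 1) * main
end

section
/- For every integer m ≥ 1, one has d_m(m+2)/d_m(m+1) < T(m+1,m), where T(m+1,m) = (2m^2 + 15m + 14 + m·√(4m^2 + 4m + 5)) / (4(m+2)). -/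
/-- The summands of `d n m` with `k < m` vanish. -/
theorem sum_range_boros_moll_eq_zero (n m : ℕ) :
    ∑ k ∈ Finset.range m,
      (2 : ℝ) ^ k * (Nat.choose (2 * n - 2 * k) (n - k) : ℝ) *
        (Nat.choose (n + k) n : ℝ) * (Nat.choose k m : ℝ) = 0 :=
  Finset.sum_eq_zero fun k hk => by
    rw [Nat.choose_eq_zero_of_lt (Finset.mem_range.1 hk), Nat.cast_zero, mul_zero]

theorem d_succ_self (m : ℕ) :
    d (m + 1) m =
      2 ^ (m + 1) * (Nat.choose (2 * m + 1) (m + 1) : ℝ) * (2 * m + 3) / 4 ^ (m + 1) := by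
  have hc : Nat.choose (2 * m + 2) (m + 1) = 2 * Nat.choose (2 * m + 1) (m + 1) := by
    rw [Nat.choose_succ_succ', Nat.choose_symm_half]; ring
  unfold d
  rw [Finset.sum_range_succ, Finset.sum_range_succ, sum_range_boros_moll_eq_zero,
    show 2 * (m + 1) - 2 * m = 2 by lia, show m + 1 - m = 1 by lia,
    show m + 1 + m = 2 * m + 1 by ring, show m + 1 + (m + 1) = 2 * m + 2 by ring, hc]
  simp
  ring

theorem d_add_two_self (m : ℕ) :
    d (m + 2) m =
      2 ^ (m + 1) * (Nat.choose (2 * m + 1) (m + 1) : ℝ) *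
        (2 * (m + 1) * (4 * m ^ 2 + 18 * m + 21)) / (m + 2) / 4 ^ (m + 2) := by
  have hm : (m : ℝ) + 2 ≠ 0 := by positivity
  have h₁ : Nat.choose (2 * m + 2) (m + 1) = 2 * Nat.choose (2 * m + 1) (m + 1) := by
    rw [Nat.choose_succ_succ', Nat.choose_symm_half]; ring
  have h₂ : (Nat.choose (2 * m + 2) (m + 2) : ℝ) =
      2 * Nat.choose (2 * m + 1) (m + 1) * (m + 1) / (m + 2) := by
    have h := Nat.choose_succ_right_eq (2 * m + 2) (m + 1)
    rw [h₁, show 2 * m + 2 - (m + 1) = m + 1 by lia] at h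
    rw [eq_div_iff hm]
    exact_mod_cast h
  have h₃ : (Nat.choose (2 * m + 3) (m + 2) : ℝ) =
      2 * Nat.choose (2 * m + 1) (m + 1) * (2 * m + 3) / (m + 2) := by
    rw [Nat.choose_succ_succ', Nat.cast_add, h₁, h₂]
    push_cast
    field_simp
    ring
  have h₄ : Nat.choose (2 * m + 4) (m + 2) = 2 * Nat.choose (2 * m + 3) (m + 2) := by
    have h := Nat.choose_symm_half (m + 1)
    rw [show 2 * (m + 1) + 1 = 2 * m + 3 by ring] at h
    rw [Nat.choose_succ_succ', ← h]; ring
  have h₅ : (Nat.choose (m + 2) m : ℝ) = (m + 2) * (m + 1) / 2 := by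
    rw [Nat.choose_symm_add, Nat.cast_choose_two]
    push_cast
    ring
  unfold d
  rw [Finset.sum_range_succ, Finset.sum_range_succ, Finset.sum_range_succ,
    sum_range_boros_moll_eq_zero,
    show 2 * (m + 2) - 2 * m = 4 by lia, show m + 2 - m = 2 by lia,
    show 2 * (m + 2) - 2 * (m + 1) = 2 by lia, show m + 2 - (m + 1) = 1 by lia,
    show m + 2 + m = 2 * m + 2 by ring, show m + 2 + (m + 1) = 2 * m + 3 by ring,
    show m + 2 + (m + 2) = 2 * m + 4 by ring, h₄, h₅, Nat.cast_mul, h₂, h₃,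
    show Nat.choose 4 2 = 6 from rfl]
  simp
  field_simp
  ring

theorem d_add_two_div_d_succ (m : ℕ) :
    d (m + 2) m / d (m + 1) m =
      2 * (m + 1) * (4 * m ^ 2 + 18 * m + 21) / (2 * m + 3) / (4 * (m + 2)) := by
  have hc : (Nat.choose (2 * m + 1) (m + 1) : ℝ) ≠ 0 := by
    exact_mod_cast (Nat.choose_pos (by lia)).ne'
  rw [d_add_two_self, d_succ_self]
  field_simp
  ring

theorem div_lt_sqrt_quadratic {x : ℝ} (hx : 0 ≤ x) :
    (4 * x ^ 2 + 8 * x + 5) / (2 * x + 3) < Real.sqrt (4 * x ^ 2 + 4 * x + 5) := by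
  apply Real.lt_sqrt_of_sq_lt
  rw [div_pow, div_lt_iff₀ (by positivity)]
  nlinarith

theorem boros_moll_dm_ratio_two_lt (m : ℕ) (hm : 1 ≤ m) :
    d (m + 2) m / d (m + 1) m <
      (2 * (m : ℝ) ^ 2 + 15 * m + 14 + m * Real.sqrt (4 * (m : ℝ) ^ 2 + 4 * m + 5)) /
        (4 * ((m : ℝ) + 2)) := by
  have hm₀ : (0 : ℝ) < m := by exact_mod_cast hm
  rw [d_add_two_div_d_succ]
  gcongr
  calc 2 * ((m : ℝ) + 1) * (4 * m ^ 2 + 18 * m + 21) / (2 * m + 3)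
      = 2 * (m : ℝ) ^ 2 + 15 * m + 14 + m * ((4 * m ^ 2 + 8 * m + 5) / (2 * m + 3)) := by
        field_simp
        ring
    _ < _ := by
        gcongr
        exact div_lt_sqrt_quadratic hm₀.le
end

section
/- For every integer n ≥ 2, the coefficient sequence of the Bessel polynomial y_n is reverse ultra log-concave: with b_k = (n+k)! / (2^k · k! · (n−k)!) for 0 ≤ k ≤ n, one has k(n−k)·b_k^2 ≤ (n−k+1)(k+1)·b_{k-1}·b_{k+1} for all 1 ≤ k ≤ n−1. -/
/-- The coefficient `b_k` of the Bessel polynomial `y_n`: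
`b_k = (n+k)! / (2^k * k! * (n-k)!)`, as a real number. -/
noncomputable def besselCoeff (n k : ℕ) : ℝ :=
  (Nat.factorial (n + k) : ℝ) / (2 ^ k * (Nat.factorial k : ℝ) * (Nat.factorial (n - k) : ℝ))

theorem besselCoeff_nonneg (n k : ℕ) : 0 ≤ besselCoeff n k := by
  unfold besselCoeff
  positivity

theorem two_mul_succ_mul_besselCoeff_succ {n k : ℕ} (h : k < n) :
    2 * ((k : ℝ) + 1) * besselCoeff n (k + 1) =
      ((n : ℝ) + k + 1) * ((n : ℝ) - k) * besselCoeff n k := by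
  obtain ⟨m, rfl⟩ := Nat.exists_eq_add_of_lt h
  have h₁ : k + m + 1 - (k + 1) = m := by omega
  have h₂ : k + m + 1 - k = m + 1 := by omega
  have h₃ : k + m + 1 + (k + 1) = (k + m + 1 + k) + 1 := by omega
  unfold besselCoeff
  rw [h₁, h₂, h₃, Nat.factorial_succ (k + m + 1 + k), Nat.factorial_succ k,
    Nat.factorial_succ m]
  push_cast
  field_simp
  ring

theorem bessel_reverse_ultra_log_concave (n k : ℕ) (hn : 2 ≤ n) (hk : 1 ≤ k)
    (hk' : k ≤ n - 1) :
    (k : ℝ) * ((n : ℝ) - k) * besselCoeff n k ^ 2 ≤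
      ((n : ℝ) - k + 1) * ((k : ℝ) + 1) * besselCoeff n (k - 1) * besselCoeff n (k + 1) := by
  obtain ⟨j, rfl⟩ := Nat.exists_eq_add_of_le' hk
  have hlt : j + 1 < n := by omega
  have hnj : (0 : ℝ) ≤ (n : ℝ) - (j + 1) := by
    rw [sub_nonneg]
    exact_mod_cast hlt.le
  have h₁ := two_mul_succ_mul_besselCoeff_succ (show j < n by omega)
  have h₂ := two_mul_succ_mul_besselCoeff_succ hlt
  have hpos : 0 ≤ ((n : ℝ) - (j + 1)) * ((n : ℝ) - (j + 1) + 1) *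
      (besselCoeff n j * besselCoeff n (j + 1)) :=
    mul_nonneg (mul_nonneg hnj (by linarith))
      (mul_nonneg (besselCoeff_nonneg n j) (besselCoeff_nonneg n (j + 1)))
  rw [Nat.add_sub_cancel]
  push_cast at h₂ ⊢
  linear_combination (1 / 2) * hpos +
    (1 / 2) * ((n : ℝ) - (j + 1)) * besselCoeff n (j + 1) * h₁ -
    (1 / 2) * ((n : ℝ) - (j + 1) + 1) * besselCoeff n j * h₂
end
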